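/- Let ψ_a(z) = max(z,0) + a·min(z,0) be the leaky ReLU activation with slope a ∈ [0,1), and let Z be a standard real Gaussian random variable. Then E[ψ_a(Z)²] = (1−a)²/2 + a, and for every ρ ∈ [-1,1) with θ = arccos ρ, the quantity λ3 := ( (1−a)²·(π − θ)/(2π) + a ) / ( (1−a)²/2 + a ) satisfies λ3 < 1. -/

import Mathlib

open Real MeasureTheory

/-- Standard Gaussian probability density function. -/
noncomputable def gpdf (x : ℝ) : ℝ := (Real.sqrt (2 * Real.pi))⁻¹ * Real.exp (-(x ^ 2) / 2)

theorem gpdf_eq_gaussianPDFReal : gpdf = ProbabilityTheory.gaussianPDFReal 0 1 := by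
  ext x
  simp [gpdf, ProbabilityTheory.gaussianPDFReal]

theorem integral_sq_mul_gpdf : ∫ z : ℝ, z ^ 2 * gpdf z = 1 := by
  have h := ProbabilityTheory.variance_fun_id_gaussianReal (μ := 0) (v := 1)
  rw [ProbabilityTheory.variance_eq_integral measurable_id'.aemeasurable,
    ProbabilityTheory.integral_id_gaussianReal,
    ProbabilityTheory.integral_gaussianReal_eq_integral_smul one_ne_zero] at h
  simpa [gpdf_eq_gaussianPDFReal, mul_comm] using h

theorem integrable_sq_mul_gpdf : Integrable fun z : ℝ => z ^ 2 * gpdf z :=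
  .of_integral_ne_zero (by rw [integral_sq_mul_gpdf]; exact one_ne_zero)

theorem continuous_gpdf : Continuous gpdf := by
  unfold gpdf
  fun_prop

theorem integrable_mul_abs_mul_gpdf : Integrable fun z : ℝ => z * |z| * gpdf z := by
  refine integrable_sq_mul_gpdf.mono
    (Continuous.aestronglyMeasurable (by have := continuous_gpdf; fun_prop)) ?_
  refine .of_forall fun z => le_of_eq ?_
  simp [sq]

theorem integral_mul_abs_mul_gpdf : ∫ z : ℝ, z * |z| * gpdf z = 0 := by
  have h := integral_neg_eq_self (fun z : ℝ => z * |z| * gpdf z) volume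
  have hodd (z : ℝ) : -z * |-z| * gpdf (-z) = -(z * |z| * gpdf z) := by
    simp [gpdf]
  simp only [hodd, integral_neg] at h
  linarith

theorem leakyReLU_sq (a z : ℝ) :
    (max z 0 + a * min z 0) ^ 2 = (1 + a ^ 2) / 2 * z ^ 2 + (1 - a ^ 2) / 2 * (z * |z|) := by
  rcases le_total 0 z with h | h
  · rw [max_eq_left h, min_eq_right h, abs_of_nonneg h]
    ring
  · rw [max_eq_right h, min_eq_left h, abs_of_nonpos h]
    ring

/-- For the leaky ReLU `ψ_a(z) = max(z,0) + a·min(z,0)` with slope `a ∈ [0,1)` and a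
standard Gaussian `Z`, we have `E[ψ_a(Z)²] = (1−a)²/2 + a`, and for every `ρ ∈ [-1,1)`
with `θ = arccos ρ`, the eigenvalue
`λ₃ = ((1−a)²·(π − θ)/(2π) + a) / ((1−a)²/2 + a)` satisfies `λ₃ < 1`. -/
theorem lrelu_second_moment_and_contraction (a : ℝ) (ha : a ∈ Set.Ico (0 : ℝ) 1) :
    (∫ z : ℝ, (max z 0 + a * min z 0) ^ 2 * gpdf z) = (1 - a) ^ 2 / 2 + a ∧
    ∀ ρ ∈ Set.Ico (-1 : ℝ) 1,
      ((1 - a) ^ 2 * (Real.pi - Real.arccos ρ) / (2 * Real.pi) + a) /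
        ((1 - a) ^ 2 / 2 + a) < 1 := by
  obtain ⟨ha0, ha1⟩ := ha
  have hsq : 0 < (1 - a) ^ 2 := pow_pos (sub_pos.mpr ha1) 2
  refine ⟨?_, fun ρ hρ => ?_⟩
  · simp only [leakyReLU_sq, add_mul, mul_assoc ((1 + a ^ 2) / 2), mul_assoc ((1 - a ^ 2) / 2)]
    rw [integral_add (integrable_sq_mul_gpdf.const_mul _) (integrable_mul_abs_mul_gpdf.const_mul _),
      integral_const_mul, integral_const_mul, integral_sq_mul_gpdf, integral_mul_abs_mul_gpdf]
    ring
  · have hθ : 0 < Real.arccos ρ := Real.arccos_pos.mpr hρ.2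
    rw [div_lt_one (by positivity), add_lt_add_iff_right,
      div_lt_div_iff₀ (by positivity) two_pos]
    nlinarith [mul_pos hsq hθ]
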